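/- Assume all gaps are open. For every ε > 0 there is N₀ such that for all n ≥ N₀, every band B, and every pair x < x' of consecutive zeros of p_n in the interior of B (consecutive meaning p_n has no zero in the open interval (x, x')), one has | (n/(p·π)) · |arccos(Δ(x')/2) − arccos(Δ(x)/2)| − 1 | < ε. (This is the clock-spacing statement (1.8) of Theorem 2.5: on each band the function x ↦ arccos(Δ(x)/2)/(p·π) agrees, up to sign and an additive constant, with the distribution function k(x) of the equilibrium measure of the band set.) -/

import Mathlib

open Polynomial Matrix Real

/-- The one-step transfer matrix `A_k(x)` for periodic OPRL (real form). -/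
noncomputable def JacobiA (a b : ℕ → ℝ) (k : ℕ) (x : ℝ) : Matrix (Fin 2) (Fin 2) ℝ :=
  (a (k + 1))⁻¹ • !![x - b (k + 1), -(a k); a (k + 1), 0]

/-- The transfer matrix `T_n(x) = A_{n-1}(x) ⋯ A_0(x)`. -/
noncomputable def JacobiT (a b : ℕ → ℝ) : ℕ → ℝ → Matrix (Fin 2) (Fin 2) ℝ
  | 0, _ => 1
  | n + 1, x => JacobiA a b n x * JacobiT a b n x

/-- The discriminant `Δ(x) = tr T_p(x)`. -/
noncomputable def JacobiDisc (a b : ℕ → ℝ) (p : ℕ) (x : ℝ) : ℝ :=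
  (JacobiT a b p x).trace

/-- The band set `{x : Δ(x) ∈ [-2,2]}`. -/
noncomputable def bandSet (a b : ℕ → ℝ) (p : ℕ) : Set ℝ :=
  {x : ℝ | JacobiDisc a b p x ∈ Set.Icc (-2 : ℝ) 2}

/-- A band is a connected component of the band set. -/
def IsBand (a b : ℕ → ℝ) (p : ℕ) (B : Set ℝ) : Prop :=
  ∃ x ∈ bandSet a b p, B = connectedComponentIn (bandSet a b p) x

/-- The transfer matrix `T_n`, with polynomial entries. -/
noncomputable def jacobiPolyT (a b : ℕ → ℝ) : ℕ → Matrix (Fin 2) (Fin 2) ℝ[X]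
  | 0 => 1
  | n + 1 => !![C (a (n + 1))⁻¹ * (X - C (b (n + 1))), -C ((a (n + 1))⁻¹ * a n); 1, 0] *
      jacobiPolyT a b n

lemma jacobiPolyT_succ_zero (a b : ℕ → ℝ) (n : ℕ) (j : Fin 2) :
    jacobiPolyT a b (n + 1) 0 j = C (a (n + 1))⁻¹ * (X - C (b (n + 1))) * jacobiPolyT a b n 0 j -
      C ((a (n + 1))⁻¹ * a n) * jacobiPolyT a b n 1 j := by
  rw [jacobiPolyT, Matrix.mul_apply, Fin.sum_univ_two]
  simp
  ring

lemma jacobiPolyT_succ_one (a b : ℕ → ℝ) (n : ℕ) (j : Fin 2) :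
    jacobiPolyT a b (n + 1) 1 j = jacobiPolyT a b n 0 j := by
  rw [jacobiPolyT, Matrix.mul_apply, Fin.sum_univ_two]
  simp

lemma jacobiPolyT_map_eval {a b : ℕ → ℝ} (ha : ∀ n, 1 ≤ n → 0 < a n) (n : ℕ) (x : ℝ) :
    (jacobiPolyT a b n).map (eval x) = JacobiT a b n x := by
  induction n with
  | zero => ext i j; fin_cases i <;> fin_cases j <;> simp [jacobiPolyT, JacobiT]
  | succ n ih =>
    have h := (ha (n + 1) (by omega)).ne'
    rw [JacobiT, ← ih]
    ext i j
    rw [Matrix.mul_apply, Fin.sum_univ_two]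
    fin_cases i
    · simp [jacobiPolyT_succ_zero, JacobiA]
      ring
    · simp [jacobiPolyT_succ_one, JacobiA, h]

lemma degree_jacobiPolyT {a b : ℕ → ℝ} (ha : ∀ n, 1 ≤ n → 0 < a n) (n : ℕ) :
    (jacobiPolyT a b n 0 0).degree = n ∧ (jacobiPolyT a b n 1 0).degree < n ∧
      (jacobiPolyT a b n 0 1).degree < n ∧
      (jacobiPolyT a b n 1 1).degree < ((max n 1 : ℕ) : WithBot ℕ) := by
  induction n with
  | zero =>
    simp [jacobiPolyT]
  | succ n ih =>
    obtain ⟨h00, h10, h01, h11⟩ := ih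
    have hn : (n : WithBot ℕ) < ((n + 1 : ℕ) : WithBot ℕ) := by exact_mod_cast n.lt_succ_self
    have hc : (a (n + 1))⁻¹ ≠ 0 := inv_ne_zero (ha (n + 1) (by omega)).ne'
    have hlin : (C (a (n + 1))⁻¹ * (X - C (b (n + 1)))).degree = 1 := by
      rw [degree_C_mul hc, degree_X_sub_C]
    have hmul (q : ℝ[X]) (c : ℝ) (d : WithBot ℕ) (hq : q.degree < d) :
        (C c * q).degree < d := by
      rw [← smul_eq_C_mul]
      exact (degree_smul_le c q).trans_lt hq
    have hlead : (C (a (n + 1))⁻¹ * (X - C (b (n + 1))) * jacobiPolyT a b n 0 0).degree =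
        ((n + 1 : ℕ) : WithBot ℕ) := by
      rw [degree_mul, hlin, h00, add_comm]; norm_cast
    rw [jacobiPolyT_succ_zero, jacobiPolyT_succ_zero, jacobiPolyT_succ_one, jacobiPolyT_succ_one]
    refine ⟨?_, ?_, ?_, ?_⟩
    · rw [degree_sub_eq_left_of_degree_lt, hlead]
      rw [hlead]
      exact hmul _ _ _ (h10.trans hn)
    · rw [h00]; exact hn
    · refine (degree_sub_le _ _).trans_lt (max_lt ?_ (hmul _ _ _ ?_))
      · by_cases h0 : jacobiPolyT a b n 0 1 = 0
        · simp [h0]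
        · rw [degree_eq_natDegree h0] at h01
          rw [degree_mul, hlin, degree_eq_natDegree h0]
          norm_cast at *
          omega
      · refine h11.trans_le ?_
        exact_mod_cast (by omega : max n 1 ≤ n + 1)
    · refine h01.trans_le ?_
      exact_mod_cast (by omega : n ≤ max (n + 1) 1)

/-- The discriminant as a polynomial. -/
noncomputable def jacobiDiscPoly (a b : ℕ → ℝ) (p : ℕ) : ℝ[X] :=
  jacobiPolyT a b p 0 0 + jacobiPolyT a b p 1 1

lemma eval_jacobiDiscPoly {a b : ℕ → ℝ} (ha : ∀ n, 1 ≤ n → 0 < a n) (p : ℕ) (x : ℝ) :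
    (jacobiDiscPoly a b p).eval x = JacobiDisc a b p x := by
  rw [JacobiDisc, ← jacobiPolyT_map_eval ha, Matrix.trace_fin_two, jacobiDiscPoly]
  simp

lemma degree_jacobiDiscPoly {a b : ℕ → ℝ} (ha : ∀ n, 1 ≤ n → 0 < a n) {p : ℕ} (hp : 1 ≤ p) :
    (jacobiDiscPoly a b p).degree = p := by
  obtain ⟨h00, -, -, h11⟩ := degree_jacobiPolyT (b := b) ha p
  rw [max_eq_left hp, ← h00] at h11
  rw [jacobiDiscPoly, degree_add_eq_left_of_degree_lt h11, h00]

lemma eq_jacobiPolyT_of_recurrence {a b : ℕ → ℝ} (ha : ∀ n, 1 ≤ n → 0 < a n) {P : ℕ → ℝ[X]}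
    (hP0 : P 0 = 1)
    (hPrec0 : (X : ℝ[X]) * P 0 = a 1 • P 1 + b 1 • P 0)
    (hPrec : ∀ n, 1 ≤ n →
      (X : ℝ[X]) * P n = a (n + 1) • P (n + 1) + b (n + 1) • P n + a n • P (n - 1)) (n : ℕ) :
    jacobiPolyT a b n 0 0 = P n := by
  have step (n : ℕ) (q r : ℝ[X])
      (h : (X : ℝ[X]) * q = a (n + 1) • P (n + 1) + b (n + 1) • q + a n • r) :
      C (a (n + 1))⁻¹ * (X - C (b (n + 1))) * q - C ((a (n + 1))⁻¹ * a n) * r = P (n + 1) := by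
    have hC : C (a (n + 1))⁻¹ * C (a (n + 1)) = (1 : ℝ[X]) := by
      rw [← C_mul, inv_mul_cancel₀ (ha (n + 1) (by omega)).ne', C_1]
    simp only [smul_eq_C_mul] at h
    rw [C_mul]
    linear_combination C (a (n + 1))⁻¹ * h + P (n + 1) * hC
  suffices h : jacobiPolyT a b n 0 0 = P n ∧
      jacobiPolyT a b (n + 1) 0 0 = P (n + 1) by exact h.1
  induction n with
  | zero =>
    refine ⟨by simp [jacobiPolyT, hP0], ?_⟩
    rw [← step 0 (P 0) 0 (by simpa using hPrec0)]
    simp [jacobiPolyT, hP0]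
  | succ n ih =>
    refine ⟨ih.2, ?_⟩
    rw [← step (n + 1) (P (n + 1)) (P n) (by simpa using hPrec (n + 1) (by omega)), ← ih.1,
      ← ih.2, jacobiPolyT_succ_zero _ _ (n + 1), jacobiPolyT_succ_one]

lemma det_JacobiT {a b : ℕ → ℝ} (ha : ∀ n, 1 ≤ n → 0 < a n) (n : ℕ) (x : ℝ) :
    a n * (JacobiT a b n x).det = a 0 := by
  induction n with
  | zero => simp [JacobiT]
  | succ n ih =>
    have h := (ha (n + 1) (by omega)).ne'
    rw [JacobiT, Matrix.det_mul, ← ih]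
    simp [JacobiA, Matrix.det_fin_two]
    field_simp

section Periodic

variable {a b : ℕ → ℝ} {p : ℕ}

lemma JacobiT_add_period (hpera : ∀ n, 1 ≤ n → a (n + p) = a n)
    (hperb : ∀ n, 1 ≤ n → b (n + p) = b n) (ha0 : a 0 = a p) (n : ℕ) (x : ℝ) :
    JacobiT a b (n + p) x = JacobiT a b n x * JacobiT a b p x := by
  induction n with
  | zero => simp [JacobiT]
  | succ n ih =>
    have h1 : a (n + p) = a n := by
      rcases n.eq_zero_or_pos with rfl | h
      · simp [ha0]
      · exact hpera n h
    have hA : JacobiA a b (n + p) x = JacobiA a b n x := by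
      rw [JacobiA, JacobiA, h1, show n + p + 1 = n + 1 + p by ring, hpera _ (by omega),
        hperb _ (by omega)]
    rw [show n + 1 + p = (n + p) + 1 by ring, JacobiT, ih, hA, JacobiT, Matrix.mul_assoc]

lemma sq_JacobiT_period (hp : 1 ≤ p) (ha : ∀ n, 1 ≤ n → 0 < a n) (ha0 : a 0 = a p) (x : ℝ) :
    JacobiT a b p x * JacobiT a b p x = JacobiDisc a b p x • JacobiT a b p x - 1 := by
  have hdet : (JacobiT a b p x).det = 1 := by
    have := det_JacobiT (b := b) ha p x
    rw [ha0] at this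
    exact mul_left_cancel₀ (ha p hp).ne' (by simpa using this)
  rw [Matrix.det_fin_two] at hdet
  rw [JacobiDisc, Matrix.trace_fin_two]
  ext i j
  fin_cases i <;> fin_cases j <;> simp [Matrix.mul_apply, Fin.sum_univ_two] <;> linarith

lemma JacobiT_two_periods (hp : 1 ≤ p) (ha : ∀ n, 1 ≤ n → 0 < a n)
    (hpera : ∀ n, 1 ≤ n → a (n + p) = a n) (hperb : ∀ n, 1 ≤ n → b (n + p) = b n)
    (ha0 : a 0 = a p) (n : ℕ) (x : ℝ) :
    JacobiT a b (n + p + p) x =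
      JacobiDisc a b p x • JacobiT a b (n + p) x - JacobiT a b n x := by
  rw [JacobiT_add_period hpera hperb ha0, JacobiT_add_period hpera hperb ha0, Matrix.mul_assoc,
    sq_JacobiT_period hp ha ha0, Matrix.mul_sub, Matrix.mul_smul, Matrix.mul_one]

lemma sin_mul_JacobiT (hp : 1 ≤ p) (ha : ∀ n, 1 ≤ n → 0 < a n)
    (hpera : ∀ n, 1 ≤ n → a (n + p) = a n) (hperb : ∀ n, 1 ≤ n → b (n + p) = b n)
    (ha0 : a 0 = a p) (r m : ℕ) {x θ : ℝ} (hθ : JacobiDisc a b p x = 2 * cos θ) :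
    sin θ * JacobiT a b (r + p * m) x 0 0 =
      sin (m * θ) * JacobiT a b (r + p) x 0 0 - sin ((m - 1) * θ) * JacobiT a b r x 0 0 := by
  induction m using Nat.twoStepInduction with
  | zero => simp
  | one => simp
  | more m ih1 ih2 =>
    have h := congrFun₂ (JacobiT_two_periods hp ha hpera hperb ha0 (r + p * m) x) 0 0
    simp only [Matrix.sub_apply, Matrix.smul_apply, smul_eq_mul] at h
    rw [show r + p * (m + 2) = r + p * m + p + p by ring, h]
    rw [show r + p * (m + 1) = r + p * m + p by ring] at ih2
    push_cast at ih2 ⊢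
    have trig (y : ℝ) : sin (y + θ) = 2 * cos θ * sin y - sin (y - θ) := by
      rw [sin_add, sin_sub]; ring
    have h1 := trig ((m + 1) * θ)
    have h2 := trig (m * θ)
    rw [show (m + 1) * θ + θ = ((m : ℝ) + 2) * θ by ring,
      show (m + 1) * θ - θ = (m : ℝ) * θ by ring] at h1
    rw [show m * θ + θ = ((m : ℝ) + 1) * θ by ring,
      show m * θ - θ = ((m : ℝ) - 1) * θ by ring] at h2
    rw [show ((m : ℝ) + 1 - 1) * θ = m * θ by ring] at ih2
    rw [h1, show ((m : ℝ) + 2 - 1) * θ = (m + 1) * θ by ring, hθ]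
    linear_combination 2 * cos θ * ih2 - ih1 + JacobiT a b r x 0 0 * h2

/-- If `P_r` and `P_{r+p}` vanish at `x`, then the first coordinate vector is an eigenvector
of the monodromy matrix, so `x` is not interior to the spectrum. -/
lemma four_le_sq_JacobiDisc_of_zero (hp : 1 ≤ p) (ha : ∀ n, 1 ≤ n → 0 < a n)
    (hpera : ∀ n, 1 ≤ n → a (n + p) = a n) (hperb : ∀ n, 1 ≤ n → b (n + p) = b n)
    (ha0 : a 0 = a p) {r : ℕ} {x : ℝ} (h0 : JacobiT a b r x 0 0 = 0)
    (h1 : JacobiT a b (r + p) x 0 0 = 0) : 4 ≤ JacobiDisc a b p x ^ 2 := by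
  have hdetr : (JacobiT a b r x).det ≠ 0 := by
    intro h
    have := det_JacobiT (b := b) ha r x
    rw [h, mul_zero, ha0] at this
    exact (ha p hp).ne this
  have hdet : (JacobiT a b p x).det = 1 := by
    have := det_JacobiT (b := b) ha p x
    rw [ha0] at this
    exact mul_left_cancel₀ (ha p hp).ne' (by simpa using this)
  rw [JacobiT_add_period hpera hperb ha0, Matrix.mul_apply, Fin.sum_univ_two, h0, zero_mul,
    zero_add] at h1
  rw [Matrix.det_fin_two, h0, zero_mul, zero_sub, neg_ne_zero] at hdetr
  have h10 : JacobiT a b p x 1 0 = 0 :=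
    (mul_eq_zero.mp h1).resolve_left (left_ne_zero_of_mul hdetr)
  rw [Matrix.det_fin_two, h10, mul_zero, sub_zero] at hdet
  rw [JacobiDisc, Matrix.trace_fin_two]
  nlinarith [sq_nonneg (JacobiT a b p x 0 0 - JacobiT a b p x 1 1)]

end Periodic

lemma isCompact_preimage_Icc_of_degree_pos {f : ℝ[X]} (hf : 0 < f.degree) :
    IsCompact {x | f.eval x ∈ Set.Icc (-2 : ℝ) 2} := by
  have hclosed : IsClosed {x | f.eval x ∈ Set.Icc (-2 : ℝ) 2} := isClosed_Icc.preimage f.continuous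
  have htend := f.tendsto_norm_atTop hf (tendsto_norm_cocompact_atTop (E := ℝ))
  obtain ⟨K, hK, hsub⟩ :=
    Filter.mem_cocompact.mp (htend.eventually (Filter.eventually_gt_atTop 2))
  refine hK.of_isClosed_subset hclosed fun x hx => ?_
  by_contra hxK
  have : 2 < ‖f.eval x‖ := hsub hxK
  rw [Real.norm_eq_abs] at this
  exact absurd (abs_le.mpr ⟨hx.1, hx.2⟩) this.not_ge

/-- If `f` maps the end points of `[s, t]`, but not some interior point, into `[-2, 2]`, then `f`
has a critical point in `(s, t)` whose value lies outside `[-2, 2]`. -/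
lemma exists_critical_point_in_gap {f : ℝ[X]} {s t y : ℝ} (hs : f.eval s ∈ Set.Icc (-2 : ℝ) 2)
    (ht : f.eval t ∈ Set.Icc (-2 : ℝ) 2) (hy : y ∈ Set.Icc s t)
    (hfy : f.eval y ∉ Set.Icc (-2 : ℝ) 2) :
    ∃ z ∈ Set.Ioo s t, (derivative f).eval z = 0 ∧ f.eval z ∉ Set.Icc (-2 : ℝ) 2 := by
  wlog h2 : 2 < f.eval y generalizing f
  · obtain ⟨z, hz, hz', hz''⟩ := this (f := -f)
      (by simpa [and_comm, neg_le] using hs) (by simpa [and_comm, neg_le] using ht)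
      (by simpa [and_comm, neg_le] using hfy)
      (by rw [eval_neg]; by_contra h; exact hfy ⟨by linarith, not_lt.mp h2⟩)
    exact ⟨z, hz, by simpa using hz', by simpa [and_comm, neg_le] using hz''⟩
  obtain ⟨z, hz, hmax⟩ := isCompact_Icc.exists_isMaxOn ⟨y, hy⟩ f.continuous.continuousOn
  have hz2 : 2 < f.eval z := h2.trans_le (hmax hy)
  have hsz : s ≠ z := fun h => absurd hs.2 (h ▸ hz2.not_ge)
  have htz : z ≠ t := fun h => absurd ht.2 (h ▸ hz2.not_ge)
  have hzI : z ∈ Set.Ioo s t := ⟨lt_of_le_of_ne hz.1 hsz, lt_of_le_of_ne hz.2 htz⟩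
  refine ⟨z, hzI, ?_, fun h => absurd h.2 hz2.not_ge⟩
  exact (hmax.isLocalMax (Icc_mem_nhds hzI.1 hzI.2)).hasDerivAt_eq_zero (f.hasDerivAt z)

/-- If the preimage of `[-2, 2]` under a polynomial of degree `p` has `p` components, then the
polynomial has no critical points in it. -/
lemma eval_derivative_ne_zero_of_ncard_components {f : ℝ[X]} {p : ℕ} (hp : 1 ≤ p)
    (hf : f.degree = p) {S : Set ℝ} (hS : S = {x | f.eval x ∈ Set.Icc (-2 : ℝ) 2})
    (hcard : {C : Set ℝ | ∃ x ∈ S, C = connectedComponentIn S x}.ncard = p)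
    {x₀ : ℝ} (hx₀ : x₀ ∈ S) : (derivative f).eval x₀ ≠ 0 := by
  classical
  intro hcrit
  have hnat : f.natDegree = p := natDegree_eq_of_degree_eq_some hf
  have hder : derivative f ≠ 0 := by
    intro h
    have := derivative_eq_zero.mp h
    omega
  have hdeg : (derivative f).natDegree < p := hnat ▸ natDegree_derivative_lt (by omega)
  have hfin : {C : Set ℝ | ∃ x ∈ S, C = connectedComponentIn S x}.Finite :=
    Set.finite_of_ncard_pos (by omega)
  choose! rep hrepS hrep using
    fun (C : Set ℝ) (hC : C ∈ {C : Set ℝ | ∃ x ∈ S, C = connectedComponentIn S x}) => hC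
  set s : Finset ℝ := hfin.toFinset.image rep with hs
  have hscard : s.card = p := by
    rw [hs, Finset.card_image_of_injOn, ← Set.ncard_eq_toFinset_card _ hfin, hcard]
    intro C hC D hD hCD
    rw [Finset.mem_coe, Set.Finite.mem_toFinset] at hC hD
    rw [hrep C hC, hrep D hD, hCD]
  set t : Finset ℝ := (derivative f).roots.toFinset.filter (· ∉ S) with ht
  have hst : s.card ≤ t.card + 1 := by
    refine Finset.card_le_of_interleaved fun x hx y hy hxy _ => ?_
    rw [hs, Finset.mem_image] at hx hy
    obtain ⟨C, hC, rfl⟩ := hx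
    obtain ⟨D, hD, rfl⟩ := hy
    rw [Set.Finite.mem_toFinset] at hC hD
    have hnot : ¬ Set.Icc (rep C) (rep D) ⊆ S := by
      intro hsub
      have h := isPreconnected_Icc.subset_connectedComponentIn (Set.left_mem_Icc.mpr hxy.le) hsub
      have h' := connectedComponentIn_eq (h (Set.right_mem_Icc.mpr hxy.le))
      rw [← hrep C hC, ← hrep D hD] at h'
      exact hxy.ne (h' ▸ rfl)
    obtain ⟨w, hw, hwS⟩ := Set.not_subset.mp hnot
    have hCS := hrepS C hC
    have hDS := hrepS D hD
    rw [hS] at hCS hDS hwS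
    obtain ⟨z, hz, hz', hz''⟩ := exists_critical_point_in_gap hCS hDS hw hwS
    refine ⟨z, ?_, hz⟩
    rw [ht, Finset.mem_filter, Multiset.mem_toFinset, mem_roots hder, hS]
    exact ⟨hz', hz''⟩
  have hlt : t.card < (derivative f).roots.toFinset.card := by
    refine Finset.card_lt_card (Finset.filter_ssubset.mpr ⟨x₀, ?_, not_not.mpr hx₀⟩)
    rw [Multiset.mem_toFinset, mem_roots hder]
    exact hcrit
  have hle := (Multiset.toFinset_card_le (derivative f).roots).trans (card_roots' _)
  omega

/-- The quadratic form `u² + v² - Δuv`, the squared modulus of `exp(iθ)u - v` for `Δ = 2 cos θ`. -/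
noncomputable def floquetNormSq (f u v : ℝ[X]) : ℝ[X] := u ^ 2 + v ^ 2 - f * u * v

/-- The numerator of the derivative in `θ` of the argument of `exp(iθ)u - v`, for `Δ = 2 cos θ`,
multiplied by twice the derivative of `Δ`. -/
noncomputable def floquetPhaseNum (f u v : ℝ[X]) : ℝ[X] :=
  derivative f * (2 * u ^ 2 - f * u * v) -
    (4 - f ^ 2) * (u * derivative v - v * derivative u)

lemma exists_eventually_abs_eval_le {N D : ℝ[X]} {x₀ : ℝ} (hD : D.eval x₀ ≠ 0) :
    ∃ c : ℝ, 0 ≤ c ∧ ∀ᶠ x in nhds x₀, |N.eval x| ≤ c * |D.eval x| := by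
  have hcont : ContinuousAt (fun x => |N.eval x| / |D.eval x|) x₀ :=
    N.continuous.abs.continuousAt.div D.continuous.abs.continuousAt (abs_ne_zero.mpr hD)
  refine ⟨|N.eval x₀| / |D.eval x₀| + 1, by positivity, ?_⟩
  filter_upwards [hcont.eventually (gt_mem_nhds (lt_add_one _)),
    D.continuous.continuousAt.eventually_ne hD] with x hx hDx
  exact ((div_lt_iff₀ (abs_pos.mpr hDx)).mp hx).le

lemma exists_eventually_abs_eval_le_of_simple_root {N D : ℝ[X]} {x₀ : ℝ} (hN : N.eval x₀ = 0)
    (hD : D.eval x₀ = 0) (hD' : (derivative D).eval x₀ ≠ 0) :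
    ∃ c : ℝ, 0 ≤ c ∧ ∀ᶠ x in nhds x₀, |N.eval x| ≤ c * |D.eval x| := by
  obtain ⟨N, rfl⟩ := dvd_iff_isRoot.mpr hN
  obtain ⟨D, rfl⟩ := dvd_iff_isRoot.mpr hD
  obtain ⟨c, hc, h⟩ := exists_eventually_abs_eval_le (N := N) (D := D) (x₀ := x₀)
    (by simpa using hD')
  refine ⟨c, hc, h.mono fun x hx => ?_⟩
  rw [eval_mul, eval_mul, abs_mul, abs_mul]
  nlinarith [mul_le_mul_of_nonneg_left hx (abs_nonneg (eval x (X - C x₀)))]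

/-- The phase derivative of a Floquet solution stays bounded near a simple band edge. -/
lemma exists_eventually_abs_floquetPhaseNum_le {f u v : ℝ[X]} (huv : IsCoprime u v) {x₀ : ℝ}
    (hf : f.eval x₀ ∈ Set.Icc (-2 : ℝ) 2) (hf' : (derivative f).eval x₀ ≠ 0) :
    ∃ c : ℝ, 0 ≤ c ∧ ∀ᶠ x in nhds x₀,
      |(floquetPhaseNum f u v).eval x| ≤ c * |(floquetNormSq f u v).eval x| := by
  by_cases hD : (floquetNormSq f u v).eval x₀ = 0
  swap
  · exact exists_eventually_abs_eval_le hD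
  have hne : ¬ (u.eval x₀ = 0 ∧ v.eval x₀ = 0) := by
    rintro ⟨hu, hv⟩
    obtain ⟨r, s, h⟩ := huv
    have := congrArg (eval x₀) h
    simp [hu, hv] at this
  have hD0 := hD
  simp only [floquetNormSq, eval_sub, eval_add, eval_mul, eval_pow] at hD0
  obtain ⟨s, hs, hfs, hus⟩ :
      ∃ s : ℝ, s ^ 2 = 1 ∧ f.eval x₀ = 2 * s ∧ u.eval x₀ = s * v.eval x₀ := by
    set F := f.eval x₀
    set U := u.eval x₀
    set V := v.eval x₀
    have e1 : (2 + F) * (U - V) ^ 2 + (2 - F) * (U + V) ^ 2 = 0 := by linear_combination 4 * hD0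
    have p1 : 0 ≤ (2 + F) * (U - V) ^ 2 := mul_nonneg (by linarith [hf.1]) (sq_nonneg _)
    have p2 : 0 ≤ (2 - F) * (U + V) ^ 2 := mul_nonneg (by linarith [hf.2]) (sq_nonneg _)
    have z1 : (2 + F) * (U - V) ^ 2 = 0 := by linarith
    have z2 : (2 - F) * (U + V) ^ 2 = 0 := by linarith
    rcases mul_eq_zero.mp z1 with h | h
    · refine ⟨-1, by norm_num, by linarith, ?_⟩
      rcases mul_eq_zero.mp z2 with h' | h'
      · linarith
      · linarith [pow_eq_zero_iff (two_ne_zero) |>.mp h']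
    · have hUV : U = V := sub_eq_zero.mp (pow_eq_zero_iff (two_ne_zero) |>.mp h)
      refine ⟨1, by norm_num, ?_, by linarith⟩
      rcases mul_eq_zero.mp z2 with h' | h'
      · linarith
      · have := pow_eq_zero_iff (two_ne_zero) |>.mp h'
        exact absurd ⟨by linarith, by linarith⟩ hne
  have hv : v.eval x₀ ≠ 0 := fun h => hne ⟨by rw [hus, h, mul_zero], h⟩
  have hs0 : s ≠ 0 := fun h => by simp [h] at hs
  refine exists_eventually_abs_eval_le_of_simple_root ?_ hD ?_
  · simp only [floquetPhaseNum, eval_sub, eval_mul, eval_pow, eval_ofNat, hfs, hus]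
    linear_combination 4 * (s * v.eval x₀ * (derivative v).eval x₀ -
      v.eval x₀ * (derivative u).eval x₀) * hs
  · have : (derivative (floquetNormSq f u v)).eval x₀ =
        -((derivative f).eval x₀ * s * v.eval x₀ ^ 2) := by
      simp only [floquetNormSq, derivative_sub, derivative_add, derivative_mul,
        derivative_pow, eval_sub, eval_add, eval_mul, eval_pow, hfs, hus]
      simp
      linear_combination - 2 * v.eval x₀ * (derivative v).eval x₀ * hs
    rw [this]
    exact neg_ne_zero.mpr (mul_ne_zero (mul_ne_zero hf' hs0) (pow_ne_zero 2 hv))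

lemma IsCompact.exists_uniform_bound {S : Set ℝ} (hS : IsCompact S) {N D : ℝ → ℝ}
    (h : ∀ x₀ ∈ S, ∃ c : ℝ, 0 ≤ c ∧ ∀ᶠ x in nhds x₀, |N x| ≤ c * |D x|) :
    ∃ c : ℝ, 0 ≤ c ∧ ∀ x ∈ S, |N x| ≤ c * |D x| := by
  refine hS.induction_on (p := fun S => ∃ c : ℝ, 0 ≤ c ∧ ∀ x ∈ S, |N x| ≤ c * |D x|)
    ⟨0, le_rfl, by simp⟩ (fun s t hst ⟨c, hc, hct⟩ => ⟨c, hc, fun x hx => hct x (hst hx)⟩) ?_ ?_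
  · rintro s t ⟨c, hc, hcs⟩ ⟨d, hd, hdt⟩
    refine ⟨max c d, le_max_of_le_left hc, ?_⟩
    rintro x (hx | hx)
    · exact (hcs x hx).trans (by gcongr; exact le_max_left _ _)
    · exact (hdt x hx).trans (by gcongr; exact le_max_right _ _)
  · intro x hx
    obtain ⟨c, hc, hcx⟩ := h x hx
    exact ⟨_, mem_nhdsWithin_of_mem_nhds hcx, c, hc, fun _ hy => hy⟩

/-- A bound for the phase derivative of a Floquet solution, uniform on the whole band set. -/
lemma exists_abs_floquetPhaseNum_le {f u v : ℝ[X]} (hv : v ≠ 0) {S : Set ℝ} (hS : IsCompact S)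
    (hf : ∀ x ∈ S, f.eval x ∈ Set.Icc (-2 : ℝ) 2) (hf' : ∀ x ∈ S, (derivative f).eval x ≠ 0) :
    ∃ c : ℝ, 0 ≤ c ∧ ∀ x ∈ S, |(floquetPhaseNum f u v).eval x| ≤
      c * |((derivative f) * floquetNormSq f u v).eval x| := by
  classical
  let _ : GCDMonoid ℝ[X] := EuclideanDomain.gcdMonoid ℝ[X]
  set d := gcd u v
  obtain ⟨u', hu'⟩ : d ∣ u := gcd_dvd_left u v
  obtain ⟨v', hv'⟩ : d ∣ v := gcd_dvd_right u v
  have hd : d ≠ 0 := fun h => hv (by rw [hv', h, zero_mul])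
  have huv : IsCoprime u' v' := by
    have h := isCoprime_div_gcd_div_gcd (p := u) hv
    have hu : u / d = u' := by rw [hu', mul_div_cancel_left₀ _ hd]
    have hv : v / d = v' := by rw [hv', mul_div_cancel_left₀ _ hd]
    rwa [← hu, ← hv]
  have hN : floquetPhaseNum f u v = d ^ 2 * floquetPhaseNum f u' v' := by
    rw [hu', hv']
    simp only [floquetPhaseNum, derivative_mul]
    ring
  have hD : floquetNormSq f u v = d ^ 2 * floquetNormSq f u' v' := by
    rw [hu', hv']
    simp only [floquetNormSq]
    ring
  obtain ⟨c, hc, h⟩ := hS.exists_uniform_bound (fun x₀ hx₀ =>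
    exists_eventually_abs_floquetPhaseNum_le huv (hf x₀ hx₀) (hf' x₀ hx₀))
  obtain ⟨e, he, h'⟩ := hS.exists_uniform_bound (N := fun x => (1 : ℝ[X]).eval x) (fun x₀ hx₀ =>
    exists_eventually_abs_eval_le (hf' x₀ hx₀))
  refine ⟨c * e, by positivity, fun x hx => ?_⟩
  have h1 : 1 ≤ e * |(derivative f).eval x| := by simpa using h' x hx
  rw [hN, hD]
  simp only [eval_mul, eval_pow, abs_mul, abs_pow] at *
  calc |eval x d| ^ 2 * |eval x (floquetPhaseNum f u' v')|
      ≤ |eval x d| ^ 2 * (c * |eval x (floquetNormSq f u' v')|) * 1 := by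
        rw [mul_one]; gcongr; exact h x hx
    _ ≤ |eval x d| ^ 2 * (c * |eval x (floquetNormSq f u' v')|) *
        (e * |(derivative f).eval x|) := by gcongr
    _ = _ := by ring

/-- A nowhere vanishing `C¹` function on an open interval has a differentiable logarithm. -/
lemma exists_log_of_contDiffOn {I : Set ℝ} (hI : IsOpen I) (hconn : I.OrdConnected) {g : ℝ → ℂ}
    (hg : ContDiffOn ℝ 1 g I) (hg0 : ∀ x ∈ I, g x ≠ 0) :
    ∃ L : ℝ → ℂ, ∀ x ∈ I, HasDerivAt L (deriv g x / g x) x ∧ g x = Complex.exp (L x) := by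
  rcases I.eq_empty_or_nonempty with rfl | ⟨x₀, hx₀⟩
  · exact ⟨0, by simp⟩
  have hcont : ContinuousOn (fun x => deriv g x / g x) I :=
    (hg.continuousOn_deriv_of_isOpen hI le_rfl).div hg.continuousOn hg0
  set L : ℝ → ℂ := fun x => Complex.log (g x₀) + ∫ t in x₀..x, deriv g t / g t with hL
  have hL' : ∀ x ∈ I, HasDerivAt L (deriv g x / g x) x := by
    intro x hx
    refine (intervalIntegral.integral_hasDerivAt_right ?_ ?_ ?_).const_add _
    · exact (hcont.mono (hconn.uIcc_subset hx₀ hx)).intervalIntegrable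
    · exact hcont.stronglyMeasurableAtFilter hI x hx
    · exact hcont.continuousAt (hI.mem_nhds hx)
  refine ⟨L, fun x hx => ⟨hL' x hx, ?_⟩⟩
  have hder : ∀ y ∈ I, HasDerivAt (fun t => g t * Complex.exp (-L t)) 0 y := by
    intro y hy
    have hgy := ((hg.differentiableOn one_ne_zero).differentiableAt (hI.mem_nhds hy)).hasDerivAt
    refine (hgy.mul (hL' y hy).neg.cexp).congr_deriv ?_
    have := hg0 y hy
    simp only [Pi.neg_apply]
    field_simp
    ring
  have hconst := hI.is_const_of_deriv_eq_zero hconn.isPreconnected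
    (fun y hy => (hder y hy).differentiableAt.differentiableWithinAt)
    (fun y hy => (hder y hy).deriv) hx hx₀
  have h₀ : g x₀ * Complex.exp (-L x₀) = 1 := by
    simp [hL, Complex.exp_neg, Complex.exp_log (hg0 x₀ hx₀), hg0 x₀ hx₀]
  rw [h₀, Complex.exp_neg] at hconst
  exact (mul_inv_eq_one₀ (Complex.exp_ne_zero _)).mp hconst

/-- Consecutive zeros of `sin φ` for a function `φ` without critical points are `π` apart in `φ`. -/
lemma abs_sub_eq_pi_of_consecutive_zeros {φ φ' : ℝ → ℝ} {x y : ℝ} (hxy : x < y)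
    (hφ : ∀ t ∈ Set.Icc x y, HasDerivAt φ (φ' t) t) (hφ' : ∀ t ∈ Set.Ioo x y, φ' t ≠ 0)
    (hx : sin (φ x) = 0) (hy : sin (φ y) = 0) (h : ∀ t ∈ Set.Ioo x y, sin (φ t) ≠ 0) :
    |φ y - φ x| = π := by
  have hcont : ContinuousOn φ (Set.Icc x y) := fun t ht =>
    (hφ t ht).continuousAt.continuousWithinAt
  have hne : φ x ≠ φ y := fun heq => by
    obtain ⟨c, hc, hc'⟩ := exists_hasDerivAt_eq_zero hxy hcont heq
      fun t ht => hφ t (Set.Ioo_subset_Icc_self ht)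
    exact hφ' c hc hc'
  obtain ⟨j, hj⟩ := sin_eq_zero_iff.mp hx
  obtain ⟨l, hl⟩ := sin_eq_zero_iff.mp hy
  have hmid : ∀ i : ℤ,
      ¬ ((i : ℝ) * π ∈ Set.Ioo (φ x) (φ y) ∨ (i : ℝ) * π ∈ Set.Ioo (φ y) (φ x)) := by
    rintro i (hi | hi)
    · obtain ⟨t, ht, hti⟩ := intermediate_value_Ioo hxy.le hcont hi
      exact h t ht (by rw [hti, sin_int_mul_pi])
    · obtain ⟨t, ht, hti⟩ := intermediate_value_Ioo' hxy.le hcont hi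
      exact h t ht (by rw [hti, sin_int_mul_pi])
  rw [← hj, ← hl] at hmid hne ⊢
  have hpi := pi_pos
  have hcmp (i k : ℤ) : (i : ℝ) * π < k * π ↔ i < k := by
    rw [mul_lt_mul_iff_left₀ hpi, Int.cast_lt]
  have hjl : j ≠ l := fun h => hne (by rw [h])
  have h1 := hmid (j + 1)
  have h2 := hmid (j - 1)
  simp only [Set.mem_Ioo, hcmp] at h1 h2
  have : l = j + 1 ∨ l = j - 1 := by omega
  rcases this with rfl | rfl
  · push_cast
    rw [show ((j : ℝ) + 1) * π - j * π = π by ring, abs_of_pos hpi]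
  · push_cast
    rw [show ((j : ℝ) - 1) * π - j * π = -π by ring, abs_neg, abs_of_pos hpi]

/-- Zero spacing of `sin (Mθ + γ)` in the variable `θ` when `γ` is Lipschitz in `θ`. -/
lemma abs_mul_sub_pi_le_of_consecutive_zeros {θ θ' γ γ' : ℝ → ℝ} {x y c M : ℝ} (hxy : x < y)
    (hM : c < M) (hθ : ∀ t ∈ Set.Icc x y, HasDerivAt θ (θ' t) t)
    (hγ : ∀ t ∈ Set.Icc x y, HasDerivAt γ (γ' t) t) (hθ' : ∀ t ∈ Set.Icc x y, θ' t ≠ 0)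
    (hγ' : ∀ t ∈ Set.Icc x y, |γ' t| ≤ c * |θ' t|)
    (hx : sin (M * θ x + γ x) = 0) (hy : sin (M * θ y + γ y) = 0)
    (h : ∀ t ∈ Set.Ioo x y, sin (M * θ t + γ t) ≠ 0) :
    |M * |θ y - θ x| - π| ≤ c * |θ y - θ x| := by
  have hc : 0 ≤ c := by
    have hx' := Set.left_mem_Icc.mpr hxy.le
    by_contra! hneg
    nlinarith [hγ' x hx', abs_nonneg (γ' x), abs_pos.mpr (hθ' x hx')]
  have hpi := abs_sub_eq_pi_of_consecutive_zeros (φ := fun t => M * θ t + γ t)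
    (φ' := fun t => M * θ' t + γ' t) hxy
    (fun t ht => ((hθ t ht).const_mul M).add (hγ t ht)) (fun t ht hzero => by
      have ht' := Set.Ioo_subset_Icc_self ht
      have h1 : γ' t = -(M * θ' t) := by linarith
      have h2 := hγ' t ht'
      rw [h1, abs_neg, abs_mul, abs_of_pos (hc.trans_lt hM)] at h2
      nlinarith [abs_pos.mpr (hθ' t ht')]) hx hy h
  have hlip : |γ y - γ x| ≤ c * |θ y - θ x| := by
    obtain ⟨t, ht, hts⟩ := exists_ratio_hasDerivAt_eq_ratio_slope θ θ' hxy
      (fun t ht => (hθ t ht).continuousAt.continuousWithinAt)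
      (fun t ht => hθ t (Set.Ioo_subset_Icc_self ht)) γ γ'
      (fun t ht => (hγ t ht).continuousAt.continuousWithinAt)
      (fun t ht => hγ t (Set.Ioo_subset_Icc_self ht))
    have ht' := Set.Ioo_subset_Icc_self ht
    have habs := congrArg abs hts
    rw [abs_mul, abs_mul] at habs
    refine le_of_mul_le_mul_right ?_ (abs_pos.mpr (hθ' t ht'))
    rw [habs]
    nlinarith [mul_le_mul_of_nonneg_left (hγ' t ht') (abs_nonneg (θ y - θ x))]
  refine le_trans ?_ hlip
  rw [← hpi, ← abs_of_pos (hc.trans_lt hM), ← abs_mul, abs_of_pos (hc.trans_lt hM)]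
  refine (abs_abs_sub_abs_le_abs_sub _ _).trans (le_of_eq ?_)
  rw [← abs_neg]
  congr 1
  ring

lemma hasDerivAt_arccos_half {f : ℝ[X]} {x : ℝ} (hx : f.eval x ∈ Set.Ioo (-2 : ℝ) 2) :
    HasDerivAt (fun x => arccos (f.eval x / 2))
      (-(derivative f).eval x / (2 * sin (arccos (f.eval x / 2)))) x := by
  have h := (hasDerivAt_arccos (x := f.eval x / 2) (by linarith [hx.1]) (by linarith [hx.2])).comp x
    ((f.hasDerivAt x).div_const 2)
  refine h.congr_deriv ?_
  rw [sin_arccos]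
  ring

lemma sin_arccos_half_pos {y : ℝ} (hy : y ∈ Set.Ioo (-2 : ℝ) 2) : 0 < sin (arccos (y / 2)) := by
  rw [sin_arccos]
  exact Real.sqrt_pos.mpr (by nlinarith [hy.1, hy.2])

lemma cos_arccos_half {y : ℝ} (hy : y ∈ Set.Ioo (-2 : ℝ) 2) : cos (arccos (y / 2)) = y / 2 :=
  cos_arccos (by linarith [hy.1]) (by linarith [hy.2])

/-- The function `exp(iθ)u - v` with `θ = arccos (f / 2)`. -/
noncomputable def floquetFun (f u v : ℝ[X]) (x : ℝ) : ℂ :=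
  Complex.exp ((arccos (f.eval x / 2) : ℝ) * Complex.I) * (u.eval x : ℝ) - (v.eval x : ℝ)

section Floquet

variable {f u v : ℝ[X]} {x : ℝ}

lemma floquetFun_re : (floquetFun f u v x).re =
    cos (arccos (f.eval x / 2)) * u.eval x - v.eval x := by
  simp only [floquetFun, Complex.sub_re, Complex.re_mul_ofReal, Complex.exp_ofReal_mul_I_re,
    Complex.ofReal_re]

lemma floquetFun_im : (floquetFun f u v x).im = sin (arccos (f.eval x / 2)) * u.eval x := by
  simp only [floquetFun, Complex.sub_im, Complex.im_mul_ofReal, Complex.exp_ofReal_mul_I_im,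
    Complex.ofReal_im, sub_zero]

lemma normSq_floquetFun (hx : f.eval x ∈ Set.Ioo (-2 : ℝ) 2) :
    Complex.normSq (floquetFun f u v x) = (floquetNormSq f u v).eval x := by
  have hcs := sin_sq_add_cos_sq (arccos (f.eval x / 2))
  rw [Complex.normSq_apply, floquetFun_re, floquetFun_im, floquetNormSq]
  simp only [eval_sub, eval_add, eval_mul, eval_pow]
  have hc := cos_arccos_half hx
  linear_combination u.eval x ^ 2 * hcs - 2 * u.eval x * v.eval x * hc

lemma floquetFun_ne_zero (hx : f.eval x ∈ Set.Ioo (-2 : ℝ) 2)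
    (huv : ¬ (u.eval x = 0 ∧ v.eval x = 0)) : floquetFun f u v x ≠ 0 := by
  intro h
  have him := floquetFun_im (f := f) (u := u) (v := v) (x := x)
  have hre := floquetFun_re (f := f) (u := u) (v := v) (x := x)
  rw [h, Complex.zero_im, eq_comm, mul_eq_zero] at him
  have hu := him.resolve_left (sin_arccos_half_pos hx).ne'
  rw [h, hu, Complex.zero_re] at hre
  exact huv ⟨hu, by linarith⟩

lemma contDiffAt_floquetFun (hx : f.eval x ∈ Set.Ioo (-2 : ℝ) 2) :
    ContDiffAt ℝ 1 (floquetFun f u v) x := by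
  have hpoly (q : ℝ[X]) : ContDiffAt ℝ 1 (fun t => q.eval t) x := by
    have h := (q.contDiff_aeval (𝕜 := ℝ) 1).contDiffAt (x := x)
    simp only [coe_aeval_eq_eval] at h
    exact h
  have hofReal (h : ℝ → ℝ) (hh : ContDiffAt ℝ 1 h x) : ContDiffAt ℝ 1 (fun t => (h t : ℂ)) x :=
    Complex.ofRealCLM.contDiff.contDiffAt.comp x hh
  have hθ : ContDiffAt ℝ 1 (fun x => arccos (f.eval x / 2)) x :=
    (contDiffAt_arccos (by linarith [hx.1]) (by linarith [hx.2])).comp x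
      ((hpoly f).div_const 2)
  exact (((hofReal _ hθ).mul contDiffAt_const).cexp.mul
    (hofReal _ (hpoly u))).sub (hofReal _ (hpoly v))

lemma hasDerivAt_floquetFun {θ' : ℝ}
    (hθ' : HasDerivAt (fun x => arccos (f.eval x / 2)) θ' x) :
    HasDerivAt (floquetFun f u v)
      (⟨-θ' * sin (arccos (f.eval x / 2)) * u.eval x +
          cos (arccos (f.eval x / 2)) * (derivative u).eval x - (derivative v).eval x,
        θ' * cos (arccos (f.eval x / 2)) * u.eval x +
          sin (arccos (f.eval x / 2)) * (derivative u).eval x⟩ : ℂ) x := by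
  refine ((((hθ'.ofReal_comp).mul_const Complex.I).cexp.mul
    (u.hasDerivAt x).ofReal_comp).sub (v.hasDerivAt x).ofReal_comp).congr_deriv ?_
  apply Complex.ext <;>
    simp only [Complex.exp_ofReal_mul_I_re, Complex.exp_ofReal_mul_I_im, Complex.sub_re,
      Complex.sub_im, Complex.add_re, Complex.add_im, Complex.mul_re, Complex.mul_im,
      Complex.ofReal_re, Complex.ofReal_im, Complex.I_re, Complex.I_im] <;>
    ring

lemma im_deriv_floquetFun_div (hx : f.eval x ∈ Set.Ioo (-2 : ℝ) 2) {θ' : ℝ}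
    (hθ' : HasDerivAt (fun x => arccos (f.eval x / 2)) θ' x)
    (huv : ¬ (u.eval x = 0 ∧ v.eval x = 0)) :
    2 * (deriv (floquetFun f u v) x / floquetFun f u v x).im *
      ((derivative f) * floquetNormSq f u v).eval x = θ' * (floquetPhaseNum f u v).eval x := by
  have hD : Complex.normSq (floquetFun f u v x) ≠ 0 :=
    Complex.normSq_eq_zero.not.mpr (floquetFun_ne_zero hx huv)
  have hs := sin_arccos_half_pos hx
  have hf : (derivative f).eval x = -(2 * sin (arccos (f.eval x / 2)) * θ') := by
    rw [hθ'.unique (hasDerivAt_arccos_half hx)]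
    field_simp
  have hc : f.eval x = 2 * cos (arccos (f.eval x / 2)) := by rw [cos_arccos_half hx]; ring
  have hcs := sin_sq_add_cos_sq (arccos (f.eval x / 2))
  rw [(hasDerivAt_floquetFun hθ').deriv, Complex.div_im, eval_mul, ← normSq_floquetFun hx,
    ← sub_div, floquetFun_re, floquetFun_im, hf]
  have hcancel (X n F : ℝ) (hn : n ≠ 0) : 2 * (X / n) * (F * n) = 2 * X * F := by field_simp
  rw [hcancel _ _ _ hD]
  simp only [floquetPhaseNum, eval_sub, eval_mul, eval_pow, eval_ofNat, hf]
  generalize arccos (f.eval x / 2) = t at *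
  rw [hc]
  linear_combination (-4 * sin t * θ' ^ 2 * u.eval x ^ 2 -
    4 * θ' * (u.eval x * (derivative v).eval x - v.eval x * (derivative u).eval x)) * hcs

end Floquet

/-- On an interval inside the bands, consecutive zeros of `sin((M+1)θ)u - sin(Mθ)v` are
asymptotically `π / M` apart in `θ`. -/
lemma abs_mul_sub_pi_le_of_floquet {f u v : ℝ[X]} {I : Set ℝ} (hI : IsOpen I)
    (hconn : I.OrdConnected) (hf : ∀ x ∈ I, f.eval x ∈ Set.Ioo (-2 : ℝ) 2)
    (hf' : ∀ x ∈ I, (derivative f).eval x ≠ 0)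
    (huv : ∀ x ∈ I, ¬ (u.eval x = 0 ∧ v.eval x = 0)) {c M : ℝ} (hM : c < M)
    (hbound : ∀ x ∈ I, |(floquetPhaseNum f u v).eval x| ≤
      c * |((derivative f) * floquetNormSq f u v).eval x|)
    {θ F : ℝ → ℝ} (hθ : θ = fun x => arccos (f.eval x / 2))
    (hF : ∀ x ∈ I, F x = sin ((M + 1) * θ x) * u.eval x - sin (M * θ x) * v.eval x)
    {x y : ℝ} (hx : x ∈ I) (hy : y ∈ I) (hxy : x < y) (hFx : F x = 0) (hFy : F y = 0)
    (hFt : ∀ t ∈ Set.Ioo x y, F t ≠ 0) :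
    |M * |θ y - θ x| - π| ≤ c * |θ y - θ x| := by
  obtain ⟨L, hL⟩ := exists_log_of_contDiffOn hI hconn
    (fun x hx => (contDiffAt_floquetFun (u := u) (v := v) (hf x hx)).contDiffWithinAt)
    (fun x hx => floquetFun_ne_zero (hf x hx) (huv x hx))
  have hsub : Set.Icc x y ⊆ I := hconn.out hx hy
  have hFL : ∀ t ∈ I, F t = Real.exp (L t).re * sin (M * θ t + (L t).im) := by
    intro t ht
    have h := (hL t ht).2
    have hre := congrArg Complex.re h
    have him := congrArg Complex.im h
    rw [floquetFun_re, Complex.exp_re] at hre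
    rw [floquetFun_im, Complex.exp_im] at him
    rw [hF t ht, hθ, add_mul, one_mul, sin_add, sin_add]
    linear_combination sin (M * arccos (f.eval t / 2)) * hre +
      cos (M * arccos (f.eval t / 2)) * him
  have hF0 : ∀ t ∈ I, F t = 0 ↔ sin (M * θ t + (L t).im) = 0 := fun t ht => by
    rw [hFL t ht, mul_eq_zero, or_iff_right (Real.exp_pos _).ne']
  have hθ' : ∀ t ∈ I, HasDerivAt θ
      (-(derivative f).eval t / (2 * sin (arccos (f.eval t / 2)))) t := fun t ht => by
    rw [hθ]; exact hasDerivAt_arccos_half (hf t ht)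
  refine abs_mul_sub_pi_le_of_consecutive_zeros hxy hM (fun t ht => hθ' t (hsub ht))
    (γ := fun t => (L t).im) (γ' := fun t => (deriv (floquetFun f u v) t / floquetFun f u v t).im)
    (fun t ht => ?_) (fun t ht => ?_) (fun t ht => ?_) ((hF0 x hx).mp hFx) ((hF0 y hy).mp hFy)
    (fun t ht => (hF0 t (hsub (Set.Ioo_subset_Icc_self ht))).not.mp (hFt t ht))
  · exact Complex.imCLM.hasFDerivAt.comp_hasDerivAt t (hL t (hsub ht)).1
  · exact div_ne_zero (neg_ne_zero.mpr (hf' t (hsub ht)))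
      (mul_ne_zero two_ne_zero (sin_arccos_half_pos (hf t (hsub ht))).ne')
  · have htI := hsub ht
    have hid := congrArg abs (im_deriv_floquetFun_div (hf t htI)
      (hθ ▸ hθ' t htI) (huv t htI))
    have hDne : 0 < |((derivative f) * floquetNormSq f u v).eval t| := by
      rw [eval_mul, ← normSq_floquetFun (hf t htI)]
      exact abs_pos.mpr (mul_ne_zero (hf' t htI)
        (Complex.normSq_eq_zero.not.mpr (floquetFun_ne_zero (hf t htI) (huv t htI))))
    rw [abs_mul, abs_mul, abs_mul, abs_two] at hid
    refine le_of_mul_le_mul_right ?_ hDne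
    have h2 := mul_le_mul_of_nonneg_left (hbound t htI) (abs_nonneg
      (-(derivative f).eval t / (2 * sin (arccos (f.eval t / 2)))))
    have h3 : 0 ≤ |(deriv (floquetFun f u v) t / floquetFun f u v t).im| *
      |((derivative f) * floquetNormSq f u v).eval t| := by positivity
    linarith

/-- A polynomial without critical points on `{-2 ≤ f ≤ 2}` satisfies `-2 < f < 2` on its
interior. -/
lemma eval_mem_Ioo_of_mem_interior {f : ℝ[X]} {B : Set ℝ}
    (hB : ∀ x ∈ B, f.eval x ∈ Set.Icc (-2 : ℝ) 2) (hf' : ∀ x ∈ B, (derivative f).eval x ≠ 0)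
    {x : ℝ} (hx : x ∈ interior B) : f.eval x ∈ Set.Ioo (-2 : ℝ) 2 := by
  have hxB := interior_subset hx
  have hnhds := mem_interior_iff_mem_nhds.mp hx
  refine ⟨lt_of_le_of_ne (hB x hxB).1 fun h => hf' x hxB ?_,
    lt_of_le_of_ne (hB x hxB).2 fun h => hf' x hxB ?_⟩
  · refine IsLocalMin.hasDerivAt_eq_zero (f := fun t => f.eval t) (a := x) ?_ (f.hasDerivAt x)
    filter_upwards [hnhds] with y hy
    rw [← h]
    exact (hB y hy).1
  · refine IsLocalMax.hasDerivAt_eq_zero (f := fun t => f.eval t) (a := x) ?_ (f.hasDerivAt x)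
    filter_upwards [hnhds] with y hy
    rw [h]
    exact (hB y hy).2

/-- If `mδ = π + O(δ)` with `m` the integral part of `n / p`, then `nδ / (pπ)` is close to `1`. -/
lemma abs_div_mul_sub_one_lt {n p : ℕ} (hp : 1 ≤ p) {c δ ε : ℝ} (hε : 0 < ε)
    (hδ : 0 ≤ δ) (hn : c + 2 + (c + 2) / ε < n / p)
    (h : |(((n / p : ℕ) : ℝ) - 1) * δ - π| ≤ c * δ) :
    |(n : ℝ) / (p * π) * δ - 1| < ε := by
  have hp0 : (0 : ℝ) < p := by exact_mod_cast hp
  have hpi := pi_pos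
  have hle : ((n / p : ℕ) : ℝ) ≤ n / p := Nat.cast_div_le
  have hlt : (n : ℝ) / p < ((n / p : ℕ) : ℝ) + 1 := by
    rw [div_lt_iff₀ hp0]
    exact_mod_cast Nat.lt_mul_of_div_lt (Nat.lt_succ_self _) hp
  set q : ℝ := n / p with hq
  have hδ0 : 0 < δ := by
    refine hδ.lt_of_ne fun h0 => ?_
    rw [← h0, mul_zero, mul_zero, zero_sub, abs_neg, abs_of_pos hpi] at h
    linarith
  rw [abs_le] at h
  have h1 : q * δ - π ≤ (c + 2) * δ := by nlinarith
  have h2 : -((c + 2) * δ) ≤ q * δ - π := by nlinarith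
  have h3 : (c + 2) * δ < ε * π := by
    have h4 : (c + 2) / ε < q - (c + 2) := by linarith
    rw [div_lt_iff₀ hε] at h4
    nlinarith [mul_lt_mul_of_pos_right h4 hδ0]
  have h5 : (n : ℝ) / (p * π) * δ - 1 = (q * δ - π) / π := by
    rw [hq]
    field_simp
  rw [h5, abs_div, abs_of_pos hpi, div_lt_iff₀ hpi, abs_lt]
  constructor <;> linarith

/-- **Theorem 2.5, clock spacing (1.8).** Assume all gaps are open.  For every `ε > 0`
there is `N₀` such that for all `n ≥ N₀`, every band `B`, and every pair of consecutive
zeros `x < x'` of `p_n` in the interior of `B`,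
`|(n/(pπ))·|arccos(Δ(x')/2) - arccos(Δ(x)/2)| - 1| < ε`. -/
theorem oprl_periodic_clock_spacing
    (p : ℕ) (hp : 1 ≤ p) (a b : ℕ → ℝ)
    (ha : ∀ n, 1 ≤ n → 0 < a n)
    (hpera : ∀ n, 1 ≤ n → a (n + p) = a n)
    (hperb : ∀ n, 1 ≤ n → b (n + p) = b n)
    (ha0 : a 0 = a p)
    (P : ℕ → Polynomial ℝ)
    (hP0 : P 0 = 1)
    (hPrec0 : (X : Polynomial ℝ) * P 0 = a 1 • P 1 + b 1 • P 0)
    (hPrec : ∀ n, 1 ≤ n →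
      (X : Polynomial ℝ) * P n = a (n + 1) • P (n + 1) + b (n + 1) • P n + a n • P (n - 1))
    (hgaps : {C : Set ℝ | IsBand a b p C}.ncard = p) :
    ∀ ε > (0 : ℝ), ∃ N₀ : ℕ, ∀ n : ℕ, N₀ ≤ n →
      ∀ B : Set ℝ, IsBand a b p B →
        ∀ x x' : ℝ, x ∈ interior B → x' ∈ interior B →
          (P n).eval x = 0 → (P n).eval x' = 0 → x < x' →
          (∀ y ∈ Set.Ioo x x', (P n).eval y ≠ 0) →
          |(n : ℝ) / ((p : ℝ) * π) *
              |Real.arccos (JacobiDisc a b p x' / 2) - Real.arccos (JacobiDisc a b p x / 2)| -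
            1| < ε := by
  intro ε hε
  set f := jacobiDiscPoly a b p
  have hfe (x : ℝ) : f.eval x = JacobiDisc a b p x := eval_jacobiDiscPoly ha p x
  have hdeg : f.degree = p := degree_jacobiDiscPoly ha hp
  have hS : bandSet a b p = {x | f.eval x ∈ Set.Icc (-2 : ℝ) 2} := by
    simp only [bandSet, hfe]
  have hcompact : IsCompact (bandSet a b p) := by
    rw [hS]
    exact isCompact_preimage_Icc_of_degree_pos (by rw [hdeg]; exact_mod_cast hp)
  have hfS : ∀ x ∈ bandSet a b p, f.eval x ∈ Set.Icc (-2 : ℝ) 2 := fun x hx => by rwa [hS] at hx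
  have hf' : ∀ x ∈ bandSet a b p, (derivative f).eval x ≠ 0 := fun x hx =>
    eval_derivative_ne_zero_of_ncard_components hp hdeg hS hgaps hx
  have hP (n : ℕ) : jacobiPolyT a b n 0 0 = P n :=
    eq_jacobiPolyT_of_recurrence ha hP0 hPrec0 hPrec n
  have hPe (n : ℕ) (x : ℝ) : JacobiT a b n x 0 0 = (P n).eval x := by
    rw [← jacobiPolyT_map_eval ha, Matrix.map_apply, hP]
  have hPne (n : ℕ) : P n ≠ 0 := fun h => by
    have := (degree_jacobiPolyT (b := b) ha n).1
    rw [hP, h, degree_zero] at this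
    exact WithBot.bot_ne_coe this
  choose c hc0 hc using fun r : ℕ =>
    exists_abs_floquetPhaseNum_le (u := P (r + p)) (hPne r) hcompact hfS hf'
  set c₀ : ℝ := ∑ r ∈ Finset.range p, c r
  have hc₀ : 0 ≤ c₀ := Finset.sum_nonneg fun r _ => hc0 r
  have hp0 : (0 : ℝ) < p := by exact_mod_cast hp
  obtain ⟨N₀, hN₀⟩ := exists_nat_gt ((c₀ + 2 + (c₀ + 2) / ε) * p)
  refine ⟨N₀, fun n hn B hB x x' hx hx' hzx hzx' hxx' hcons => ?_⟩
  have hnp : c₀ + 2 + (c₀ + 2) / ε < n / p := by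
    rw [lt_div_iff₀ hp0]
    exact hN₀.trans_le (by exact_mod_cast hn)
  refine abs_div_mul_sub_one_lt hp hε (abs_nonneg _) hnp ?_
  set m := n / p
  set r := n % p
  have hrm : r + p * m = n := Nat.mod_add_div n p
  have hm : c₀ < (m : ℝ) - 1 := by
    have h1 : (n : ℝ) / p < (m : ℝ) + 1 := by
      rw [div_lt_iff₀ hp0]
      exact_mod_cast Nat.lt_mul_of_div_lt (Nat.lt_succ_self _) hp
    have h2 : 0 ≤ (c₀ + 2) / ε := by positivity
    linarith
  obtain ⟨x₀, -, rfl⟩ := hB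
  have hsub := connectedComponentIn_subset (bandSet a b p) x₀
  have hIS := interior_subset.trans hsub
  have hIoo : ∀ y ∈ interior (connectedComponentIn (bandSet a b p) x₀),
      f.eval y ∈ Set.Ioo (-2 : ℝ) 2 := fun y hy =>
    eval_mem_Ioo_of_mem_interior (fun z hz => hfS z (hsub hz)) (fun z hz => hf' z (hsub hz)) hy
  have hconn := isPreconnected_connectedComponentIn (F := bandSet a b p) (x := x₀)
    |>.ordConnected.interior
  simp only [← hfe]
  refine abs_mul_sub_pi_le_of_floquet (u := P (r + p)) (v := P r) isOpen_interior hconn hIoo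
    (fun y hy => hf' y (hIS hy)) (fun y hy huv => ?_) hm (fun y hy => ?_) rfl
    (F := fun y => sin (arccos (f.eval y / 2)) * (P n).eval y) (fun y hy => ?_) hx hx' hxx'
    (by simp [hzx]) (by simp [hzx']) (fun y hy => ?_)
  · have h4 := four_le_sq_JacobiDisc_of_zero hp ha hpera hperb ha0 ((hPe r y).trans huv.2)
      ((hPe (r + p) y).trans huv.1)
    have := hIoo y hy
    rw [hfe] at this
    nlinarith [this.1, this.2]
  · refine (hc r y (hIS hy)).trans (mul_le_mul_of_nonneg_right ?_ (abs_nonneg _))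
    exact Finset.single_le_sum (f := c) (fun i _ => hc0 i)
      (Finset.mem_range.mpr (Nat.mod_lt n hp))
  · have := sin_mul_JacobiT hp ha hpera hperb ha0 r m (x := y) (θ := arccos (f.eval y / 2))
      (by rw [cos_arccos_half (hIoo y hy), ← hfe]; ring)
    rw [hrm, hPe, hPe, hPe] at this
    simpa using this
  · exact mul_ne_zero (sin_arccos_half_pos
      (hIoo y (hconn.out hx hx' (Set.Ioo_subset_Icc_self hy)))).ne' (hcons y hy)
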